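/- Let Y, A be {0,1}-valued random variables with positive-probability cells {A=a, Y=y}, X a random variable in a measurable space, R* a version of E[Y | σ(X,A)] (the Bayes optimal regressor), and R̂ a [0,1]-valued random variable. Let ℓ : {0,1}×{0,1} → [0,1] be a bounded loss with ℓ(0,0) = ℓ(1,1) = 0. Then there exists an equalized odds predictor Ŷ derived from (R̂, A) such that E[ℓ(Ŷ, Y)] ≤ E[ℓ(Y*, Y)] + 2√2 · d_K(R̂, R*), where Y* is an optimal equalized odds predictor, i.e., E[ℓ(Y*,Y)] is the infimum of E[ℓ(·, Y)] over all randomized predictors based on (X, A) satisfying equalized odds. The analogous statement holds for equal opportunity. -/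

import Mathlib

open MeasureTheory ProbabilityTheory
open scoped ENNReal

/-- The σ-algebra generated by a pair of random variables. -/
def pairSigma {Ω β γ : Type*} [MeasurableSpace β] [MeasurableSpace γ]
    (X : Ω → β) (A : Ω → γ) : MeasurableSpace Ω :=
  MeasurableSpace.comap (fun ω => (X ω, A ω)) inferInstance

/-- Geometry for equalized odds: two ROC triangles share a good point. -/
lemma geom_odds (F T : Bool → ℝ) (hF : ∀ a, F a ∈ Set.Icc (0:ℝ) 1)
    (hT : ∀ a, T a ∈ Set.Icc (0:ℝ) 1) (f t d : ℝ) (hf : f ∈ Set.Icc (0:ℝ) 1)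
    (ht : t ∈ Set.Icc (0:ℝ) 1)
    (hFd : ∀ a, F a ≤ f + d) (hTd : ∀ a, t - d ≤ T a) :
    ∃ α β : Bool → ℝ, (∀ a, 0 ≤ α a) ∧ (∀ a, 0 ≤ β a) ∧ (∀ a, α a + β a ≤ 1) ∧
      (α false * F false + β false = α true * F true + β true) ∧
      (α false * T false + β false = α true * T true + β true) ∧
      (∀ a, α a * F a + β a ≤ f + d) ∧ (∀ a, t - d ≤ α a * T a + β a) := by
  by_cases h : ∃ a, T a ≤ F a
  · obtain ⟨a, ha⟩ := h
    have h1 := hFd a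
    have h2 := hTd a
    refine ⟨fun _ => 0, fun _ => (f + t) / 2, ?_, ?_, ?_, ?_, ?_, ?_, ?_⟩
    · simp
    · intro _; linarith [hf.1, ht.1]
    · intro _; linarith [hf.2, ht.2]
    · simp
    · simp
    · intro _; linarith
    · intro _; linarith
  · push Not at h
    have hu : ∀ a, 0 < T a - F a := fun a => sub_pos.2 (h a)
    obtain ⟨φ, hφ, i, hi⟩ : ∃ φ : ℝ, (∀ a, F a / (T a - F a) ≤ φ) ∧
        ∃ i, φ = F i / (T i - F i) := by
      obtain ⟨i, hi⟩ := Finite.exists_max (fun a => F a / (T a - F a))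
      exact ⟨_, hi, i, rfl⟩
    obtain ⟨ψ, hψ, j, hj⟩ : ∃ φ : ℝ, (∀ a, (1 - T a) / (T a - F a) ≤ φ) ∧
        ∃ i, φ = (1 - T i) / (T i - F i) := by
      obtain ⟨i, hi⟩ := Finite.exists_max (fun a => (1 - T a) / (T a - F a))
      exact ⟨_, hi, i, rfl⟩
    have hφ0 : 0 ≤ φ := hi ▸ div_nonneg (hF i).1 (hu i).le
    have hψ0 : 0 ≤ ψ := hj ▸ div_nonneg (by linarith [(hT j).2]) (hu j).le
    have hD : 0 < 1 + φ + ψ := by linarith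
    set u := 1 / (1 + φ + ψ) with hudef
    have hu0 : 0 < u := by positivity
    have huD : u * (1 + φ + ψ) = 1 := by rw [hudef]; field_simp
    have e1 : ∀ a, u / (T a - F a) * F a = u * (F a / (T a - F a)) := fun a => by ring
    have e2 : ∀ a, u / (T a - F a) * (T a - F a) = u := fun a => by
      have := (hu a).ne'
      field_simp
    have e3 : ∀ a, u / (T a - F a) * (1 - T a) = u * ((1 - T a) / (T a - F a)) :=
      fun a => by ring
    have k1 : ∀ a, u * (F a / (T a - F a)) ≤ u * φ := fun a =>
      mul_le_mul_of_nonneg_left (hφ a) hu0.le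
    have k3 : ∀ a, u * ((1 - T a) / (T a - F a)) ≤ u * ψ := fun a =>
      mul_le_mul_of_nonneg_left (hψ a) hu0.le
    have hα : ∀ a, u / (T a - F a) ≤ 1 := fun a => by
      linarith [e1 a, e2 a, e3 a, k1 a, k3 a]
    have hα0 : ∀ a, 0 ≤ u / (T a - F a) := fun a => div_nonneg hu0.le (hu a).le
    have P : ∀ a, u / (T a - F a) * F a + (u * φ - u * (F a / (T a - F a))) = u * φ :=
      fun a => by linarith [e1 a]
    have Q : ∀ a, u / (T a - F a) * T a + (u * φ - u * (F a / (T a - F a))) = u * φ + u :=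
      fun a => by linarith [e1 a, e2 a]
    refine ⟨fun a => u / (T a - F a), fun a => u * φ - u * (F a / (T a - F a)),
      hα0, fun a => sub_nonneg.2 (k1 a), fun a => ?_, ?_, ?_, fun a => ?_, fun a => ?_⟩
    · show u / (T a - F a) + (u * φ - u * (F a / (T a - F a))) ≤ 1
      linarith [e1 a, e2 a, e3 a, k1 a, k3 a]
    · exact (P false).trans (P true).symm
    · exact (Q false).trans (Q true).symm
    · refine (P a).trans_le ?_
      have : u / (T i - F i) * F i ≤ F i := mul_le_of_le_one_left (hF i).1 (hα i)
      have h2 := e1 i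
      rw [← hi] at h2
      linarith [hFd i]
    · refine le_trans ?_ (Q a).ge
      have : u / (T j - F j) * (1 - T j) ≤ 1 - T j :=
        mul_le_of_le_one_left (by linarith [(hT j).2]) (hα j)
      have h2 := e3 j
      rw [← hj] at h2
      linarith [hTd j]

/-- Geometry for equal opportunity. -/
lemma geom_opp (F T : Bool → ℝ) (hF : ∀ a, F a ∈ Set.Icc (0:ℝ) 1)
    (hT : ∀ a, T a ∈ Set.Icc (0:ℝ) 1) (f : Bool → ℝ) (t d : ℝ)
    (hFd : ∀ a, F a ≤ f a + d) (hTd : ∀ a, t - d ≤ T a) :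
    ∃ α β : Bool → ℝ, (∀ a, 0 ≤ α a) ∧ (∀ a, 0 ≤ β a) ∧ (∀ a, α a + β a ≤ 1) ∧
      (α false * T false + β false = α true * T true + β true) ∧
      (∀ a, α a * F a + β a ≤ f a + d) ∧ (∀ a, t - d ≤ α a * T a + β a) := by
  obtain ⟨i, hi⟩ := Finite.exists_min T
  have key : ∀ a, T i / T a * T a = T i := fun a => by
    rcases (hT a).1.eq_or_lt with h | h
    · have : T i = 0 := le_antisymm (h ▸ hi a) (hT i).1
      simp [this]
    · field_simp
  have h1 : ∀ a, T i / T a ≤ 1 := fun a => div_le_one_of_le₀ (hi a) (hT a).1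
  refine ⟨fun a => T i / T a, fun _ => 0, fun a => div_nonneg (hT i).1 (hT a).1,
    fun _ => le_rfl, fun a => by simpa using h1 a, ?_, fun a => ?_, fun a => ?_⟩
  · simp [key]
  · have := mul_le_of_le_one_left (hF a).1 (h1 a)
    simp only [add_zero]
    linarith [hFd a]
  · simpa [key] using hTd i

lemma tendsto_Ioi_Ici (ν : Measure ℝ) [IsProbabilityMeasure ν] (τ : ℝ) :
    Filter.Tendsto (fun n : ℕ => ν.real (Set.Ioi (τ - 1 / ((n:ℝ) + 1)))) Filter.atTop
      (nhds (ν.real (Set.Ici τ))) := by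
  have hs : Set.Ici τ = ⋂ n : ℕ, Set.Ioi (τ - 1 / ((n:ℝ) + 1)) := by
    ext x
    simp only [Set.mem_Ici, Set.mem_iInter, Set.mem_Ioi]
    constructor
    · intro h n
      have : 0 < 1 / ((n:ℝ) + 1) := by positivity
      linarith
    · intro h
      by_contra hx
      push Not at hx
      obtain ⟨n, hn⟩ := exists_nat_one_div_lt (sub_pos.2 hx)
      linarith [h n]
  have hanti : Antitone fun n : ℕ => Set.Ioi (τ - 1 / ((n:ℝ) + 1)) := by
    intro m n hmn
    apply Set.Ioi_subset_Ioi
    have := one_div_le_one_div_of_le (by positivity : (0:ℝ) < (m:ℝ) + 1)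
      (by have : (m:ℝ) ≤ n := by exact_mod_cast hmn
          linarith : (m:ℝ) + 1 ≤ n + 1)
    linarith
  have := tendsto_measure_iInter_atTop (μ := ν)
    (fun n : ℕ => (measurableSet_Ioi (a := τ - 1 / ((n:ℝ) + 1))).nullMeasurableSet) hanti
    ⟨0, measure_ne_top _ _⟩
  rw [← hs] at this
  exact (ENNReal.tendsto_toReal (measure_ne_top _ _)).comp this

lemma tendsto_Ioi_Ioi (ν : Measure ℝ) [IsProbabilityMeasure ν] (τ : ℝ) :
    Filter.Tendsto (fun n : ℕ => ν.real (Set.Ioi (τ + 1 / ((n:ℝ) + 1)))) Filter.atTop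
      (nhds (ν.real (Set.Ioi τ))) := by
  have hs : Set.Ioi τ = ⋃ n : ℕ, Set.Ioi (τ + 1 / ((n:ℝ) + 1)) := by
    ext x
    simp only [Set.mem_iUnion, Set.mem_Ioi]
    constructor
    · intro h
      obtain ⟨n, hn⟩ := exists_nat_one_div_lt (sub_pos.2 h)
      exact ⟨n, by linarith⟩
    · rintro ⟨n, h⟩
      have : 0 < 1 / ((n:ℝ) + 1) := by positivity
      linarith
  have hmono : Monotone fun n : ℕ => Set.Ioi (τ + 1 / ((n:ℝ) + 1)) := by
    intro m n hmn
    apply Set.Ioi_subset_Ioi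
    have := one_div_le_one_div_of_le (by positivity : (0:ℝ) < (m:ℝ) + 1)
      (by have : (m:ℝ) ≤ n := by exact_mod_cast hmn
          linarith : (m:ℝ) + 1 ≤ n + 1)
    linarith
  have := tendsto_measure_iUnion_atTop (μ := ν) hmono
  rw [← hs] at this
  exact (ENNReal.tendsto_toReal (measure_ne_top _ _)).comp this

/-- Neyman–Pearson: a point satisfying all the dual inequalities is dominated by a
randomized threshold. -/
lemma neyman_pearson (ν0 ν1 : Measure ℝ) [IsProbabilityMeasure ν0] [IsProbabilityMeasure ν1]
    (h00 : ∀ s < 0, ν0.real (Set.Ioi s) = 1) (h10 : ∀ s < 0, ν1.real (Set.Ioi s) = 1)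
    (h01 : ν0.real (Set.Ici 1) = 0) (P0 P1 f t : ℝ) (hP0 : 0 < P0) (hP1 : 0 < P1)
    (hf : f ∈ Set.Icc (0:ℝ) 1) (ht : t ∈ Set.Icc (0:ℝ) 1)
    (hdual : ∀ s ∈ Set.Icc (0:ℝ) 1,
      s * P0 * (ν0.real (Set.Ioi s) - f) ≤ (1 - s) * P1 * (ν1.real (Set.Ioi s) - t)) :
    ∃ τ l : ℝ, l ∈ Set.Icc (0:ℝ) 1 ∧
      l * ν0.real (Set.Ici τ) + (1 - l) * ν0.real (Set.Ioi τ) ≤ f ∧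
      t ≤ l * ν1.real (Set.Ici τ) + (1 - l) * ν1.real (Set.Ioi τ) := by
  have hdual' : ∀ s ≤ 1,
      s * P0 * (ν0.real (Set.Ioi s) - f) ≤ (1 - s) * P1 * (ν1.real (Set.Ioi s) - t) := by
    intro s hs
    rcases lt_or_ge s 0 with h | h
    · rw [h00 s h, h10 s h]
      have h1 : s * P0 * (1 - f) ≤ 0 :=
        mul_nonpos_of_nonpos_of_nonneg (mul_nonpos_of_nonpos_of_nonneg h.le hP0.le)
          (by linarith [hf.2])
      have h2 : 0 ≤ (1 - s) * P1 * (1 - t) :=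
        mul_nonneg (mul_nonneg (by linarith) hP1.le) (by linarith [ht.2])
      linarith
    · exact hdual s ⟨h, hs⟩
  have lim : Filter.Tendsto (fun n : ℕ => 1 / ((n:ℝ) + 1)) Filter.atTop (nhds 0) :=
    tendsto_one_div_add_atTop_nhds_zero_nat
  have hpos : ∀ n : ℕ, 0 < 1 / ((n:ℝ) + 1) := fun n => by positivity
  set S : Set ℝ := {s | 0 ≤ s ∧ ν0.real (Set.Ioi s) ≤ f} with hS
  have hbdd : BddBelow S := ⟨0, fun s hs => hs.1⟩
  have h1S : (1:ℝ) ∈ S := by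
    refine ⟨zero_le_one, le_trans ?_ hf.1⟩
    rw [← h01]
    exact measureReal_mono Set.Ioi_subset_Ici_self
  set τ := sInf S with hτ
  have hτ1 : τ ≤ 1 := csInf_le hbdd h1S
  have hτ0 : 0 ≤ τ := le_csInf ⟨1, h1S⟩ fun s hs => hs.1
  have hlow : ν0.real (Set.Ioi τ) ≤ f := by
    refine le_of_tendsto' (tendsto_Ioi_Ioi ν0 τ) fun n => ?_
    obtain ⟨s, hsS, hs⟩ := exists_lt_of_csInf_lt ⟨1, h1S⟩
      (lt_add_of_pos_right (sInf S) (hpos n))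
    exact (measureReal_mono (Set.Ioi_subset_Ioi hs.le)).trans hsS.2
  have hhigh : f ≤ ν0.real (Set.Ici τ) := by
    refine ge_of_tendsto' (tendsto_Ioi_Ici ν0 τ) fun n => ?_
    rcases lt_or_ge (τ - 1 / ((n:ℝ) + 1)) 0 with h | h
    · rw [h00 _ h]; exact hf.2
    · by_contra hc
      push Not at hc
      have : τ ≤ τ - 1 / ((n:ℝ) + 1) := csInf_le hbdd ⟨h, hc.le⟩
      linarith [hpos n]
  have limτ : Filter.Tendsto (fun n : ℕ => τ - 1 / ((n:ℝ) + 1)) Filter.atTop (nhds τ) := by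
    simpa using lim.const_sub τ
  have hdualIci : τ * P0 * (ν0.real (Set.Ici τ) - f) ≤
      (1 - τ) * P1 * (ν1.real (Set.Ici τ) - t) := by
    refine le_of_tendsto_of_tendsto'
      ((limτ.mul_const P0).mul ((tendsto_Ioi_Ici ν0 τ).sub_const f))
      (((limτ.const_sub 1).mul_const P1).mul ((tendsto_Ioi_Ici ν1 τ).sub_const t)) ?_
    intro n
    exact hdual' _ (by linarith [hpos n])
  rcases hτ1.eq_or_lt with h | h
  · refine ⟨1, 1, by simp, by simp [h01, hf.1], ?_⟩
    have hf0 : f = 0 := le_antisymm (by rw [← h01, ← h]; exact hhigh) hf.1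
    simp only [one_mul, sub_self, zero_mul, add_zero]
    refine ge_of_tendsto' (tendsto_Ioi_Ici ν1 1) fun n => ?_
    rcases lt_or_ge ((1:ℝ) - 1 / ((n:ℝ) + 1)) 0 with h' | h'
    · rw [h10 _ h']; exact ht.2
    · have := hdual' (1 - 1 / ((n:ℝ) + 1)) (by linarith [hpos n])
      have h2 : 0 ≤ (1 - 1 / ((n:ℝ) + 1)) * P0 *
          (ν0.real (Set.Ioi (1 - 1 / ((n:ℝ) + 1))) - f) :=
        mul_nonneg (mul_nonneg h' hP0.le) (by rw [hf0, sub_zero]; exact measureReal_nonneg)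
      have h3 := nonneg_of_mul_nonneg_right (h2.trans this)
        (mul_pos (by linarith [hpos n]) hP1)
      linarith
  · obtain ⟨l, hl, hlf⟩ : ∃ l ∈ Set.Icc (0:ℝ) 1,
        l * ν0.real (Set.Ici τ) + (1 - l) * ν0.real (Set.Ioi τ) = f := by
      have : f ∈ segment ℝ (ν0.real (Set.Ioi τ)) (ν0.real (Set.Ici τ)) := by
        rw [segment_eq_Icc (hlow.trans hhigh)]; exact ⟨hlow, hhigh⟩
      obtain ⟨a, b, ha, hb, hab, he⟩ := this
      refine ⟨b, ⟨hb, by linarith⟩, ?_⟩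
      rw [← he, ← hab]; simp only [smul_eq_mul]; ring
    refine ⟨τ, l, hl, hlf.le, ?_⟩
    have e1 := mul_le_mul_of_nonneg_left hdualIci hl.1
    have e2 := mul_le_mul_of_nonneg_left (hdual' τ hτ1) (sub_nonneg.2 hl.2)
    have e3 : 0 ≤ (1 - τ) * P1 *
        (l * ν1.real (Set.Ici τ) + (1 - l) * ν1.real (Set.Ioi τ) - t) := by
      have : l * (τ * P0 * (ν0.real (Set.Ici τ) - f)) +
          (1 - l) * (τ * P0 * (ν0.real (Set.Ioi τ) - f)) = 0 := by
        have : l * (τ * P0 * (ν0.real (Set.Ici τ) - f)) +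
          (1 - l) * (τ * P0 * (ν0.real (Set.Ioi τ) - f)) = τ * P0 *
            (l * ν0.real (Set.Ici τ) + (1 - l) * ν0.real (Set.Ioi τ) - f) := by ring
        rw [this, hlf]; simp
      linarith
    have := nonneg_of_mul_nonneg_right e3 (mul_pos (by linarith) hP1)
    linarith

section cells

variable {Ω : Type*} {m : MeasurableSpace Ω} [mΩ : MeasurableSpace Ω]

lemma meas_cell {Y A : Ω → Bool} (hY : Measurable Y) (hA : Measurable A) (a y : Bool) :
    MeasurableSet {ω | A ω = a ∧ Y ω = y} :=
  (hA (measurableSet_singleton a)).inter (hY (measurableSet_singleton y))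

lemma setIntegral_cell (μ : Measure Ω) [IsProbabilityMeasure μ] {s : Set Ω}
    (hpos : μ s ≠ 0) (u : Ω → ℝ) :
    ∫ ω in s, u ω ∂μ = μ.real s * ∫ ω, u ω ∂(μ[|s]) := by
  rw [ProbabilityTheory.cond, integral_smul_measure, smul_eq_mul, ENNReal.toReal_inv,
    ← Measure.real, ← mul_assoc, mul_inv_cancel₀, one_mul]
  rw [Measure.real, ENNReal.toReal_ne_zero]
  exact ⟨hpos, measure_ne_top _ _⟩

lemma integral_cells (μ : Measure Ω) {Y A : Ω → Bool} (hY : Measurable Y) (hA : Measurable A)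
    (u : Ω → ℝ) (hu : Integrable u μ) :
    ∫ ω, u ω ∂μ = ∑ a : Bool, ∑ y : Bool, ∫ ω in {ω | A ω = a ∧ Y ω = y}, u ω ∂μ := by
  have : ∀ ω, u ω = ∑ a : Bool, ∑ y : Bool, {ω | A ω = a ∧ Y ω = y}.indicator u ω := by
    intro ω
    simp only [Fintype.sum_bool, Set.indicator, Set.mem_ofPred_eq]
    rcases Bool.eq_false_or_eq_true (A ω) with h1 | h1 <;>
      rcases Bool.eq_false_or_eq_true (Y ω) with h2 | h2 <;> simp [h1, h2]
  have hi : ∀ a y : Bool, Integrable ({ω | A ω = a ∧ Y ω = y}.indicator u) μ :=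
    fun a y => hu.indicator (meas_cell hY hA a y)
  calc ∫ ω, u ω ∂μ
      = ∫ ω, ∑ a : Bool, ∑ y : Bool, {ω | A ω = a ∧ Y ω = y}.indicator u ω ∂μ :=
        integral_congr_ae (Filter.Eventually.of_forall this)
    _ = _ := by
        rw [integral_finsetSum _ fun a _ => integrable_finsetSum _ fun y _ => hi a y]
        refine Finset.sum_congr rfl fun a _ => ?_
        rw [integral_finsetSum _ fun y _ => hi a y]
        refine Finset.sum_congr rfl fun y _ => ?_
        rw [integral_indicator (meas_cell hY hA a y)]

lemma integrable_of_Icc (μ : Measure Ω) [IsFiniteMeasure μ] (u : Ω → ℝ)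
    (hu : Measurable u) (h : ∀ ω, u ω ∈ Set.Icc (0:ℝ) 1) : Integrable u μ := by
  refine Integrable.of_bound hu.aestronglyMeasurable 1 (Filter.Eventually.of_forall fun ω => ?_)
  rw [Real.norm_eq_abs, abs_le]
  exact ⟨by linarith [(h ω).1], (h ω).2⟩

lemma integral_mem_Icc (μ : Measure Ω) [IsProbabilityMeasure μ] (u : Ω → ℝ)
    (hu : Measurable u) (h : ∀ ω, u ω ∈ Set.Icc (0:ℝ) 1) :
    ∫ ω, u ω ∂μ ∈ Set.Icc (0:ℝ) 1 := by
  refine ⟨integral_nonneg fun ω => (h ω).1, ?_⟩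
  have := integral_mono (integrable_of_Icc μ u hu h) (integrable_const (1:ℝ)) fun ω => (h ω).2
  simpa using this

/-- The expected loss in terms of the conditional means. -/
lemma loss_eq (μ : Measure Ω) [IsProbabilityMeasure μ] {Y A : Ω → Bool}
    (hY : Measurable Y) (hA : Measurable A)
    (hpos : ∀ a y : Bool, μ {ω | A ω = a ∧ Y ω = y} ≠ 0)
    (L : Bool → Bool → ℝ) (hL00 : L false false = 0) (hL11 : L true true = 0)
    (p : Ω → ℝ) (hp : Measurable p) (hp01 : ∀ ω, p ω ∈ Set.Icc (0:ℝ) 1) :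
    ∫ ω, (p ω * L true (Y ω) + (1 - p ω) * L false (Y ω)) ∂μ =
      ∑ a : Bool, (μ.real {ω | A ω = a ∧ Y ω = false} * L true false *
          (∫ ω, p ω ∂(μ[|{ω | A ω = a ∧ Y ω = false}])) +
        μ.real {ω | A ω = a ∧ Y ω = true} * L false true *
          (1 - ∫ ω, p ω ∂(μ[|{ω | A ω = a ∧ Y ω = true}]))) := by
  have hLm : ∀ b, Measurable fun ω => L b (Y ω) := fun b =>
    (measurable_of_countable (L b)).comp hY
  have hpi : ∀ (ν : Measure Ω) [IsProbabilityMeasure ν], Integrable p ν := fun ν _ =>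
    integrable_of_Icc ν p hp hp01
  have hint : Integrable (fun ω => p ω * L true (Y ω) + (1 - p ω) * L false (Y ω)) μ := by
    refine Integrable.of_bound (C := (|L true true| + |L true false| + |L false true| + |L false false|))
      ((hp.mul (hLm true)).add ((measurable_const.sub hp).mul (hLm false))).aestronglyMeasurable
      (Filter.Eventually.of_forall fun ω => ?_)
    have h1 : |p ω| ≤ 1 := abs_le.2 ⟨by linarith [(hp01 ω).1], (hp01 ω).2⟩
    have h2 : |1 - p ω| ≤ 1 := abs_le.2 ⟨by linarith [(hp01 ω).2], by linarith [(hp01 ω).1]⟩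
    have h3 : ∀ x b : ℝ, |x| ≤ 1 → |x * b| ≤ |b| := fun x b hx => by
      rw [abs_mul]; exact mul_le_of_le_one_left (abs_nonneg _) hx
    refine (norm_add_le _ _).trans ?_
    simp only [Real.norm_eq_abs]
    have a1 := abs_nonneg (L true true)
    have a2 := abs_nonneg (L true false)
    have a3 := abs_nonneg (L false true)
    have a4 := abs_nonneg (L false false)
    have b1 := h3 (p ω) (L true (Y ω)) h1
    have b2 := h3 (1 - p ω) (L false (Y ω)) h2
    cases hy : Y ω <;> rw [hy] at b1 b2 <;> linarith
  rw [integral_cells μ hY hA _ hint]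
  refine Finset.sum_congr rfl fun a _ => ?_
  rw [Fintype.sum_bool, add_comm]
  congr 1
  · rw [setIntegral_congr_fun (g := fun ω => p ω * L true false) (meas_cell hY hA a false),
      setIntegral_cell μ (hpos a false), integral_mul_const]
    · ring
    · intro ω hω
      simp only [Set.mem_ofPred_eq] at hω
      simp [hω.2, hL00]
  · rw [setIntegral_congr_fun (g := fun ω => (1 - p ω) * L false true) (meas_cell hY hA a true),
      setIntegral_cell μ (hpos a true), integral_mul_const]
    · have := cond_isProbabilityMeasure (hpos a true)
      rw [integral_sub (integrable_const _) (hpi _)]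
      simp
      ring
    · intro ω hω
      simp only [Set.mem_ofPred_eq] at hω
      simp [hω.2, hL11]

/-- Defining property of the Bayes regressor tested against bounded functions. -/
lemma bayes_test (μ : Measure Ω) [IsProbabilityMeasure μ] {Y : Ω → Bool} (hY : Measurable Y)
    (hm : m ≤ mΩ) (R q : Ω → ℝ)
    (hRs : R =ᵐ[μ] μ[fun ω => if Y ω then (1:ℝ) else 0 | m])
    (hq : Measurable[m] q) (hqb : ∀ ω, |q ω| ≤ 1) :
    Integrable (fun ω => q ω * R ω) μ ∧
    ∫ ω, q ω * R ω ∂μ = ∫ ω, q ω * (if Y ω then (1:ℝ) else 0) ∂μ := by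
  have hYm : Measurable fun ω => if Y ω then (1:ℝ) else 0 :=
    (measurable_of_countable fun b : Bool => if b then (1:ℝ) else 0).comp hY
  have hYi : Integrable (fun ω => if Y ω then (1:ℝ) else 0) μ := by
    refine integrable_of_Icc μ _ hYm fun ω => ?_
    cases Y ω <;> simp
  have hqm : Measurable q := hq.mono hm le_rfl
  have hprod : Integrable (fun ω => q ω * (if Y ω then (1:ℝ) else 0)) μ :=
    hYi.bdd_mul hqm.aestronglyMeasurable (Filter.Eventually.of_forall hqb)
  have hR : Integrable R μ := integrable_condExp.congr hRs.symm
  refine ⟨hR.bdd_mul hqm.aestronglyMeasurable (Filter.Eventually.of_forall hqb), ?_⟩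
  have h1 : μ[q * (fun ω => if Y ω then (1:ℝ) else 0) | m] =ᵐ[μ] q * μ[fun ω => if Y ω then (1:ℝ) else 0 | m] :=
    condExp_mul_of_stronglyMeasurable_left hq.stronglyMeasurable hprod hYi
  calc ∫ ω, q ω * R ω ∂μ = ∫ ω, (μ[q * (fun ω => if Y ω then (1:ℝ) else 0) | m]) ω ∂μ := by
        refine integral_congr_ae ?_
        filter_upwards [h1, hRs] with ω e1 e2
        rw [e1, e2, Pi.mul_apply]
    _ = _ := by rw [integral_condExp hm]; rfl

lemma bayes_Icc (μ : Measure Ω) [IsProbabilityMeasure μ] {Y : Ω → Bool} (hY : Measurable Y)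
    (hm : m ≤ mΩ) (R : Ω → ℝ)
    (hRs : R =ᵐ[μ] μ[fun ω => if Y ω then (1:ℝ) else 0 | m]) :
    ∀ᵐ ω ∂μ, R ω ∈ Set.Icc (0:ℝ) 1 := by
  have hYm : Measurable fun ω => if Y ω then (1:ℝ) else 0 :=
    (measurable_of_countable fun b : Bool => if b then (1:ℝ) else 0).comp hY
  have hYi : Integrable (fun ω => if Y ω then (1:ℝ) else 0) μ := by
    refine integrable_of_Icc μ _ hYm fun ω => ?_
    cases Y ω <;> simp
  have h0 := condExp_mono (m := m) (integrable_zero Ω ℝ μ) hYi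
    (Filter.Eventually.of_forall fun ω => by simp only [Pi.zero_apply]; split_ifs <;> simp)
  have h1 := condExp_mono (m := m) hYi (integrable_const (1:ℝ))
    (Filter.Eventually.of_forall fun ω => by dsimp only; split_ifs <;> simp)
  rw [condExp_const hm] at h1
  rw [condExp_zero] at h0
  filter_upwards [h0, h1, hRs] with ω a b c
  rw [c]
  exact ⟨a, b⟩

/-- Integral against a group-supported test function, split over the cells. -/
lemma group_split (μ : Measure Ω) [IsProbabilityMeasure μ] {Y A : Ω → Bool}
    (hY : Measurable Y) (hA : Measurable A)
    (hpos : ∀ a y : Bool, μ {ω | A ω = a ∧ Y ω = y} ≠ 0)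
    (a : Bool) (q : Ω → ℝ) (hq : Measurable q) (hqb : ∀ ω, |q ω| ≤ 1) (s : ℝ) :
    ∫ ω, (if A ω = a then q ω else 0) * ((if Y ω then (1:ℝ) else 0) - s) ∂μ =
      (1 - s) * μ.real {ω | A ω = a ∧ Y ω = true} *
          (∫ ω, q ω ∂(μ[|{ω | A ω = a ∧ Y ω = true}])) -
        s * μ.real {ω | A ω = a ∧ Y ω = false} *
          (∫ ω, q ω ∂(μ[|{ω | A ω = a ∧ Y ω = false}])) := by
  have hYm : Measurable fun ω => (if Y ω then (1:ℝ) else 0) - s :=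
    (measurable_of_countable fun b : Bool => (if b then (1:ℝ) else 0) - s).comp hY
  have hqa : Measurable fun ω => if A ω = a then q ω else 0 :=
    Measurable.ite (hA (measurableSet_singleton a)) hq measurable_const
  have hYi : Integrable (fun ω => (if Y ω then (1:ℝ) else 0) - s) μ := by
    refine Integrable.of_bound (C := 1 + |s|) hYm.aestronglyMeasurable (Filter.Eventually.of_forall fun ω => ?_)
    refine (norm_sub_le _ _).trans ?_
    rw [Real.norm_eq_abs s]
    gcongr
    split_ifs <;> simp
  have hint : Integrable (fun ω => (if A ω = a then q ω else 0) *
      ((if Y ω then (1:ℝ) else 0) - s)) μ := by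
    refine hYi.bdd_mul (c := 1) hqa.aestronglyMeasurable (Filter.Eventually.of_forall fun ω => ?_)
    split_ifs
    · exact hqb ω
    · simp
  rw [integral_cells μ hY hA _ hint, Finset.sum_eq_single a]
  · rw [Fintype.sum_bool, sub_eq_add_neg]
    congr 1
    · rw [setIntegral_congr_fun (g := fun ω => q ω * (1 - s)) (meas_cell hY hA a true),
        setIntegral_cell μ (hpos a true), integral_mul_const]
      · ring
      · intro ω hω
        simp only [Set.mem_ofPred_eq] at hω
        simp [hω.1, hω.2]
    · rw [setIntegral_congr_fun (g := fun ω => q ω * (- s)) (meas_cell hY hA a false),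
        setIntegral_cell μ (hpos a false), integral_mul_const]
      · ring
      · intro ω hω
        simp only [Set.mem_ofPred_eq] at hω
        simp [hω.1, hω.2]
  · intro b _ hb
    refine Finset.sum_eq_zero fun y _ => ?_
    rw [setIntegral_congr_fun (g := fun ω => (0:ℝ)) (meas_cell hY hA b y)]
    · simp
    · intro ω hω
      simp only [Set.mem_ofPred_eq] at hω
      simp [hω.1, hb]
  · simp

/-- Dual inequality for predictors based on the σ-algebra. -/
lemma dual_ineq (μ : Measure Ω) [IsProbabilityMeasure μ] {Y A : Ω → Bool}
    (hY : Measurable Y) (hm : m ≤ mΩ)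
    (hA : Measurable[m] A)
    (hpos : ∀ a y : Bool, μ {ω | A ω = a ∧ Y ω = y} ≠ 0)
    (R p : Ω → ℝ) (hRm : Measurable[m] R)
    (hRs : R =ᵐ[μ] μ[fun ω => if Y ω then (1:ℝ) else 0 | m])
    (hp : Measurable[m] p) (hp01 : ∀ ω, p ω ∈ Set.Icc (0:ℝ) 1) (a : Bool) (s : ℝ) :
    s * μ.real {ω | A ω = a ∧ Y ω = false} *
        ((μ[|{ω | A ω = a ∧ Y ω = false}]).real {ω | s < R ω} -
          ∫ ω, p ω ∂(μ[|{ω | A ω = a ∧ Y ω = false}])) ≤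
      (1 - s) * μ.real {ω | A ω = a ∧ Y ω = true} *
        ((μ[|{ω | A ω = a ∧ Y ω = true}]).real {ω | s < R ω} -
          ∫ ω, p ω ∂(μ[|{ω | A ω = a ∧ Y ω = true}])) := by
  have hA' : Measurable A := hA.mono hm le_rfl
  have hset : MeasurableSet[m] {ω | s < R ω} := hRm measurableSet_Ioi
  have hset' : MeasurableSet {ω | s < R ω} := hm _ hset
  set q : Ω → ℝ := fun ω => {ω | s < R ω}.indicator (fun _ => (1:ℝ)) ω - p ω with hqdef
  have hqm : Measurable[m] q := (measurable_const.indicator hset).sub hp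
  have hqb : ∀ ω, |q ω| ≤ 1 := by
    intro ω
    have := hp01 ω
    simp only [hqdef, Set.indicator]
    rw [abs_le]
    split_ifs <;> constructor <;> linarith [this.1, this.2]
  have hqm' : Measurable q := hqm.mono hm le_rfl
  have hqa : Measurable[m] fun ω => if A ω = a then q ω else 0 :=
    Measurable.ite (hA (measurableSet_singleton a)) hqm measurable_const
  have hqab : ∀ ω, |(if A ω = a then q ω else 0)| ≤ 1 := by
    intro ω
    split_ifs
    · exact hqb ω
    · simp
  have hcell : ∀ y, ∫ ω, q ω ∂(μ[|{ω | A ω = a ∧ Y ω = y}]) =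
      (μ[|{ω | A ω = a ∧ Y ω = y}]).real {ω | s < R ω} -
          ∫ ω, p ω ∂(μ[|{ω | A ω = a ∧ Y ω = y}]) := by
    intro y
    have := cond_isProbabilityMeasure (hpos a y)
    rw [hqdef, integral_sub ((integrable_const (1:ℝ)).indicator hset')
      (integrable_of_Icc _ p (hp.mono hm le_rfl) hp01), integral_indicator_const _ hset']
    simp
  have hsplit := group_split μ hY hA' hpos a q hqm' hqb s
  rw [hcell, hcell] at hsplit
  obtain ⟨hi, he⟩ := bayes_test μ hY hm R _ hRs hqa hqab
  have hqai : Integrable (fun ω => if A ω = a then q ω else 0) μ :=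
    Integrable.of_bound (hqa.mono hm le_rfl).aestronglyMeasurable 1
      (Filter.Eventually.of_forall hqab)
  have hYm : Measurable fun ω => if Y ω then (1:ℝ) else 0 :=
    (measurable_of_countable fun b : Bool => if b then (1:ℝ) else 0).comp hY
  have hYi : Integrable (fun ω => if Y ω then (1:ℝ) else 0) μ := by
    refine integrable_of_Icc μ _ hYm fun ω => ?_
    cases Y ω <;> simp
  have hi2 : Integrable (fun ω => (if A ω = a then q ω else 0) * (if Y ω then (1:ℝ) else 0)) μ :=
    hYi.bdd_mul (hqa.mono hm le_rfl).aestronglyMeasurable (Filter.Eventually.of_forall hqab)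
  have hnonneg : 0 ≤ ∫ ω, (if A ω = a then q ω else 0) * (R ω - s) ∂μ := by
    refine integral_nonneg fun ω => ?_
    simp only [Pi.zero_apply]
    split_ifs
    · simp only [hqdef, Set.indicator, Set.mem_ofPred_eq]
      split_ifs with h
      · exact mul_nonneg (by linarith [(hp01 ω).2]) (by linarith)
      · exact mul_nonneg_of_nonpos_of_nonpos (by linarith [(hp01 ω).1]) (by linarith)
    · simp
  have heq : ∫ ω, (if A ω = a then q ω else 0) * (R ω - s) ∂μ =
      ∫ ω, (if A ω = a then q ω else 0) * ((if Y ω then (1:ℝ) else 0) - s) ∂μ := by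
    simp only [mul_sub]
    rw [integral_sub hi (hqai.mul_const s), integral_sub hi2 (hqai.mul_const s), he]
  rw [heq, hsplit] at hnonneg
  linarith

/-- On the negatives the Bayes regressor is a.s. below one. -/
lemma bayes_lt_one (μ : Measure Ω) [IsProbabilityMeasure μ] {Y A : Ω → Bool}
    (hY : Measurable Y) (hm : m ≤ mΩ)
    (hA : Measurable[m] A)
    (hpos : ∀ a y : Bool, μ {ω | A ω = a ∧ Y ω = y} ≠ 0)
    (R : Ω → ℝ) (hRm : Measurable[m] R)
    (hRs : R =ᵐ[μ] μ[fun ω => if Y ω then (1:ℝ) else 0 | m]) (a : Bool) :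
    (μ[|{ω | A ω = a ∧ Y ω = false}]).real {ω | 1 ≤ R ω} = 0 := by
  have hA' : Measurable A := hA.mono hm le_rfl
  have hset : MeasurableSet[m] {ω | 1 ≤ R ω} := hRm measurableSet_Ici
  have hset' : MeasurableSet {ω | 1 ≤ R ω} := hm _ hset
  set q : Ω → ℝ := fun ω => {ω | 1 ≤ R ω}.indicator (fun _ => (1:ℝ)) ω with hqdef
  have hqm : Measurable[m] q := measurable_const.indicator hset
  have hqb : ∀ ω, |q ω| ≤ 1 := by
    intro ω
    simp only [hqdef, Set.indicator]
    split_ifs <;> simp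
  have hqm' : Measurable q := hqm.mono hm le_rfl
  have hqa : Measurable[m] fun ω => if A ω = a then q ω else 0 :=
    Measurable.ite (hA (measurableSet_singleton a)) hqm measurable_const
  have hqab : ∀ ω, |(if A ω = a then q ω else 0)| ≤ 1 := by
    intro ω
    split_ifs
    · exact hqb ω
    · simp
  have hsplit := group_split μ hY hA' hpos a q hqm' hqb 1
  obtain ⟨hi, he⟩ := bayes_test μ hY hm R _ hRs hqa hqab
  have hqai : Integrable (fun ω => if A ω = a then q ω else 0) μ :=
    Integrable.of_bound (hqa.mono hm le_rfl).aestronglyMeasurable 1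
      (Filter.Eventually.of_forall hqab)
  have hYm : Measurable fun ω => if Y ω then (1:ℝ) else 0 :=
    (measurable_of_countable fun b : Bool => if b then (1:ℝ) else 0).comp hY
  have hYi : Integrable (fun ω => if Y ω then (1:ℝ) else 0) μ := by
    refine integrable_of_Icc μ _ hYm fun ω => ?_
    cases Y ω <;> simp
  have hi2 : Integrable (fun ω => (if A ω = a then q ω else 0) * (if Y ω then (1:ℝ) else 0)) μ :=
    hYi.bdd_mul (hqa.mono hm le_rfl).aestronglyMeasurable (Filter.Eventually.of_forall hqab)
  have hnonneg : 0 ≤ ∫ ω, (if A ω = a then q ω else 0) * (R ω - 1) ∂μ := by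
    refine integral_nonneg fun ω => ?_
    simp only [Pi.zero_apply]
    split_ifs
    · simp only [hqdef, Set.indicator, Set.mem_ofPred_eq]
      split_ifs with h
      · exact mul_nonneg (by linarith) (by linarith)
      · simp
    · simp
  have heq : ∫ ω, (if A ω = a then q ω else 0) * (R ω - 1) ∂μ =
      ∫ ω, (if A ω = a then q ω else 0) * ((if Y ω then (1:ℝ) else 0) - 1) ∂μ := by
    simp only [mul_sub]
    rw [integral_sub hi (hqai.mul_const 1), integral_sub hi2 (hqai.mul_const 1), he]
  rw [heq, hsplit] at hnonneg
  have hq0 : ∫ ω, q ω ∂(μ[|{ω | A ω = a ∧ Y ω = false}]) =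
      (μ[|{ω | A ω = a ∧ Y ω = false}]).real {ω | 1 ≤ R ω} := by
    rw [hqdef, integral_indicator_const _ hset']; simp
  rw [hq0] at hnonneg
  have hP : 0 < μ.real {ω | A ω = a ∧ Y ω = false} :=
    ENNReal.toReal_pos (hpos a false) (measure_ne_top _ _)
  have h0 : 0 ≤ (μ[|{ω | A ω = a ∧ Y ω = false}]).real {ω | 1 ≤ R ω} := measureReal_nonneg
  refine le_antisymm ?_ h0
  by_contra hc
  push Not at hc
  have := mul_pos hP hc
  linarith

end cells

/-- Randomized threshold rule. -/
noncomputable def thr (τ l : ℝ) (r : ℝ) : ℝ :=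
  l * (Set.Ici τ).indicator (fun _ => (1:ℝ)) r + (1 - l) * (Set.Ioi τ).indicator (fun _ => (1:ℝ)) r

lemma thr_measurable (τ l : ℝ) : Measurable (thr τ l) :=
  ((measurable_const.indicator measurableSet_Ici).const_mul l).add
    ((measurable_const.indicator measurableSet_Ioi).const_mul (1 - l))

lemma thr_mem (τ l : ℝ) (hl : l ∈ Set.Icc (0:ℝ) 1) (r : ℝ) : thr τ l r ∈ Set.Icc (0:ℝ) 1 := by
  obtain ⟨h0, h1⟩ := hl
  simp only [thr, Set.indicator]
  split_ifs <;> constructor <;> linarith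

lemma integral_thr {Ω : Type*} [MeasurableSpace Ω] (κ : Measure Ω) [IsProbabilityMeasure κ]
    (R : Ω → ℝ) (hR : Measurable R) (τ l : ℝ) :
    ∫ ω, thr τ l (R ω) ∂κ =
      l * (κ.map R).real (Set.Ici τ) + (1 - l) * (κ.map R).real (Set.Ioi τ) := by
  have := Measure.isProbabilityMeasure_map (μ := κ) hR.aemeasurable
  rw [← integral_map hR.aemeasurable (thr_measurable τ l).aestronglyMeasurable]
  simp only [thr]
  rw [integral_add, integral_const_mul, integral_const_mul,
    integral_indicator_const _ measurableSet_Ici, integral_indicator_const _ measurableSet_Ioi]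
  · simp
  · exact ((integrable_const (1:ℝ)).indicator measurableSet_Ici).const_mul l
  · exact ((integrable_const (1:ℝ)).indicator measurableSet_Ioi).const_mul (1 - l)

lemma thr_transfer (ν ν' : Measure ℝ) [IsProbabilityMeasure ν] [IsProbabilityMeasure ν'] (d : ℝ)
    (h : ∀ t, |ν.real (Set.Ioi t) - ν'.real (Set.Ioi t)| ≤ d) (τ l : ℝ)
    (hl : l ∈ Set.Icc (0:ℝ) 1) :
    |(l * ν.real (Set.Ici τ) + (1 - l) * ν.real (Set.Ioi τ)) -
      (l * ν'.real (Set.Ici τ) + (1 - l) * ν'.real (Set.Ioi τ))| ≤ d := by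
  have h1 : |ν.real (Set.Ici τ) - ν'.real (Set.Ici τ)| ≤ d :=
    le_of_tendsto' ((tendsto_Ioi_Ici ν τ).sub (tendsto_Ioi_Ici ν' τ)).abs fun n => h _
  have h2 := h τ
  rw [abs_le] at *
  have a1 := mul_le_mul_of_nonneg_left h1.1 hl.1
  have a2 := mul_le_mul_of_nonneg_left h1.2 hl.1
  have a3 := mul_le_mul_of_nonneg_left h2.1 (sub_nonneg.2 hl.2)
  have a4 := mul_le_mul_of_nonneg_left h2.2 (sub_nonneg.2 hl.2)
  constructor <;> linarith

/-- The loss as a function of the conditional means. -/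
noncomputable def lossFn (P : Bool → Bool → ℝ) (L : Bool → Bool → ℝ) (v : Bool → Bool → ℝ) : ℝ :=
  ∑ a : Bool, (P a false * L true false * v a false + P a true * L false true * (1 - v a true))

lemma lossFn_le (P L v N : Bool → Bool → ℝ) (d : ℝ) (hd : 0 ≤ d) (hP : ∀ a y, 0 ≤ P a y)
    (hsum : ∑ a, ∑ y, P a y = 1) (hL : ∀ yh y : Bool, L yh y ∈ Set.Icc (0:ℝ) 1)
    (h0 : ∀ a, N a false ≤ v a false + d) (h1 : ∀ a, v a true - d ≤ N a true) :
    lossFn P L N ≤ lossFn P L v + d := by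
  have key : ∀ a, P a false * L true false * N a false + P a true * L false true * (1 - N a true)
      ≤ (P a false * L true false * v a false + P a true * L false true * (1 - v a true)) +
        (P a false * d + P a true * d) := by
    intro a
    have e1 := mul_le_mul_of_nonneg_left (h0 a) (mul_nonneg (hP a false) (hL true false).1)
    have e2 := mul_le_mul_of_nonneg_left (h1 a) (mul_nonneg (hP a true) (hL false true).1)
    have e3 := mul_le_mul_of_nonneg_right
      (mul_le_of_le_one_right (hP a false) (hL true false).2) hd
    have e4 := mul_le_mul_of_nonneg_right
      (mul_le_of_le_one_right (hP a true) (hL false true).2) hd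
    linarith
  have k1 := key false
  have k2 := key true
  simp only [lossFn, Fintype.sum_bool] at *
  have : d = (P true true + P true false + (P false true + P false false)) * d := by
    rw [hsum, one_mul]
  linarith

/-- **Near optimality.** Let `R*` be a version of `E[Y ∣ σ(X,A)]` (the
Bayes optimal regressor), `R̂` a `[0,1]`-valued score, and `L` a `[0,1]`-bounded loss
with `L(0,0) = L(1,1) = 0`. Then there is an equalized odds predictor derived from
`(R̂, A)` whose expected loss exceeds the optimal expected loss among all equalized
odds randomized predictors based on `(X,A)` by at most `2√2 · d_K(R̂, R*)`; the
analogous statement holds for equal opportunity. -/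
theorem near_optimality_of_derived_equalized_odds
    {Ω β : Type*} [MeasurableSpace Ω] [MeasurableSpace β]
    (μ : Measure Ω) [IsProbabilityMeasure μ]
    (Y : Ω → Bool) (X : Ω → β) (A : Ω → Bool) (Rstar Rhat : Ω → ℝ)
    (hY : Measurable Y) (hX : Measurable X) (hA : Measurable A)
    (hRsm : Measurable[pairSigma X A] Rstar)
    (hRs : Rstar =ᵐ[μ] μ[fun ω => if Y ω then (1:ℝ) else 0 | pairSigma X A])
    (hRh : Measurable Rhat) (hRh01 : ∀ ω, Rhat ω ∈ Set.Icc (0:ℝ) 1)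
    (hpos : ∀ a y : Bool, μ {ω | A ω = a ∧ Y ω = y} ≠ 0)
    (L : Bool → Bool → ℝ) (hL : ∀ yh y : Bool, L yh y ∈ Set.Icc (0:ℝ) 1)
    (hL00 : L false false = 0) (hL11 : L true true = 0) :
    let cm : (Ω → ℝ) → Bool → Bool → ℝ := fun p a y =>
      ∫ ω, p ω ∂(μ[|{ω | A ω = a ∧ Y ω = y}])
    let EqOdds : (Ω → ℝ) → Prop := fun p => ∀ y : Bool, cm p false y = cm p true y
    let EqOpp : (Ω → ℝ) → Prop := fun p => cm p false true = cm p true true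
    let loss : (Ω → ℝ) → ℝ := fun p =>
      ∫ ω, (p ω * L true (Y ω) + (1 - p ω) * L false (Y ω)) ∂μ
    let dK : ℝ :=
      ⨆ a : Bool, ⨆ y : Bool, ⨆ t ∈ Set.Icc (0:ℝ) 1,
        |(μ[|{ω | A ω = a ∧ Y ω = y}] {ω | t < Rhat ω}).toReal -
          (μ[|{ω | A ω = a ∧ Y ω = y}] {ω | t < Rstar ω}).toReal|
    (∃ g : ℝ × Bool → ℝ, Measurable g ∧ (∀ z, g z ∈ Set.Icc (0:ℝ) 1) ∧
        EqOdds (fun ω => g (Rhat ω, A ω)) ∧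
        loss (fun ω => g (Rhat ω, A ω)) ≤
          sInf {l : ℝ | ∃ f : β × Bool → ℝ, Measurable f ∧
              (∀ z, f z ∈ Set.Icc (0:ℝ) 1) ∧
              EqOdds (fun ω => f (X ω, A ω)) ∧ l = loss (fun ω => f (X ω, A ω))} +
            2 * Real.sqrt 2 * dK) ∧
      (∃ g : ℝ × Bool → ℝ, Measurable g ∧ (∀ z, g z ∈ Set.Icc (0:ℝ) 1) ∧
        EqOpp (fun ω => g (Rhat ω, A ω)) ∧
        loss (fun ω => g (Rhat ω, A ω)) ≤
          sInf {l : ℝ | ∃ f : β × Bool → ℝ, Measurable f ∧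
              (∀ z, f z ∈ Set.Icc (0:ℝ) 1) ∧
              EqOpp (fun ω => f (X ω, A ω)) ∧ l = loss (fun ω => f (X ω, A ω))} +
            2 * Real.sqrt 2 * dK) := by
  intro cm EqOdds EqOpp loss dK
  have hm : pairSigma X A ≤ ‹MeasurableSpace Ω› := (hX.prodMk hA).comap_le
  have hpairm : Measurable[pairSigma X A] fun ω => (X ω, A ω) := comap_measurable _
  have hAm : Measurable[pairSigma X A] A := measurable_snd.comp hpairm
  have hRsm' : Measurable Rstar := hRsm.mono hm le_rfl
  have hprob : ∀ a y, IsProbabilityMeasure (μ[|{ω | A ω = a ∧ Y ω = y}]) := fun a y =>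
    cond_isProbabilityMeasure (hpos a y)
  have hac : ∀ a y, μ[|{ω | A ω = a ∧ Y ω = y}] ≪ μ := fun a y => cond_absolutelyContinuous
  set P : Bool → Bool → ℝ := fun a y => μ.real {ω | A ω = a ∧ Y ω = y} with hPdef
  have hP : ∀ a y, 0 < P a y := fun a y => ENNReal.toReal_pos (hpos a y) (measure_ne_top _ _)
  have hsum : ∑ a, ∑ y, P a y = 1 := by
    have := integral_cells μ hY hA (fun _ => (1:ℝ)) (integrable_const _)
    simpa [hPdef] using this.symm
  have hbay := bayes_Icc μ hY hm Rstar hRs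
  set G : Bool → Bool → Measure ℝ := fun a y => (μ[|{ω | A ω = a ∧ Y ω = y}]).map Rstar with hG
  set H : Bool → Bool → Measure ℝ := fun a y => (μ[|{ω | A ω = a ∧ Y ω = y}]).map Rhat with hH
  have hGp : ∀ a y, IsProbabilityMeasure (G a y) := fun a y =>
    Measure.isProbabilityMeasure_map hRsm'.aemeasurable
  have hHp : ∀ a y, IsProbabilityMeasure (H a y) := fun a y =>
    Measure.isProbabilityMeasure_map hRh.aemeasurable
  have hGI : ∀ a y t, (G a y).real (Set.Ioi t) =
      (μ[|{ω | A ω = a ∧ Y ω = y}]).real {ω | t < Rstar ω} := fun a y t =>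
    map_measureReal_apply hRsm' measurableSet_Ioi
  have hHI : ∀ a y t, (H a y).real (Set.Ioi t) =
      (μ[|{ω | A ω = a ∧ Y ω = y}]).real {ω | t < Rhat ω} := fun a y t =>
    map_measureReal_apply hRh measurableSet_Ioi
  have hGlow : ∀ a y, ∀ s < 0, (G a y).real (Set.Ioi s) = 1 := by
    intro a y s hs
    rw [hGI]
    have : {ω | s < Rstar ω} =ᵐ[μ[|{ω | A ω = a ∧ Y ω = y}]] Set.univ := by
      filter_upwards [(hac a y).ae_le hbay] with ω hω
      exact propext ⟨fun _ => trivial, fun _ => lt_of_lt_of_le hs hω.1⟩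
    rw [measureReal_congr this]
    simp
  have hGhigh : ∀ a y, ∀ s > 1, (G a y).real (Set.Ioi s) = 0 := by
    intro a y s hs
    rw [hGI]
    have : {ω | s < Rstar ω} =ᵐ[μ[|{ω | A ω = a ∧ Y ω = y}]] (∅ : Set Ω) := by
      filter_upwards [(hac a y).ae_le hbay] with ω hω
      exact propext ⟨fun (h : s < Rstar ω) => absurd hω.2 (by linarith), fun h => h.elim⟩
    rw [measureReal_congr this]
    simp
  have hdK : ∀ a y, ∀ t ∈ Set.Icc (0:ℝ) 1, |(H a y).real (Set.Ioi t) - (G a y).real (Set.Ioi t)|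
      ≤ dK := by
    intro a y t ht
    rw [hGI, hHI]
    have b1 : ∀ t, |(μ[|{ω | A ω = a ∧ Y ω = y}]).real {ω | t < Rhat ω} -
        (μ[|{ω | A ω = a ∧ Y ω = y}]).real {ω | t < Rstar ω}| ≤ 1 := by
      intro t
      have := hprob a y
      have e1 := measureReal_le_one (μ := μ[|{ω | A ω = a ∧ Y ω = y}]) (s := {ω | t < Rhat ω})
      have e2 := measureReal_le_one (μ := μ[|{ω | A ω = a ∧ Y ω = y}]) (s := {ω | t < Rstar ω})
      have e3 := measureReal_nonneg (μ := μ[|{ω | A ω = a ∧ Y ω = y}]) (s := {ω | t < Rhat ω})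
      have e4 := measureReal_nonneg (μ := μ[|{ω | A ω = a ∧ Y ω = y}]) (s := {ω | t < Rstar ω})
      rw [abs_le]
      constructor <;> linarith
    refine le_trans ?_ (le_ciSup (Set.finite_range _).bddAbove a)
    refine le_trans ?_ (le_ciSup (Set.finite_range _).bddAbove y)
    refine le_trans ?_ (le_ciSup ?_ t)
    · rw [ciSup_pos ht]; exact le_rfl
    · refine ⟨1, ?_⟩
      rintro _ ⟨t, rfl⟩
      exact Real.iSup_le (fun _ => b1 t) zero_le_one
  have hd0 : 0 ≤ dK := (abs_nonneg _).trans (hdK false false 0 (by simp))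
  have hdK' : ∀ a y, ∀ t, |(H a y).real (Set.Ioi t) - (G a y).real (Set.Ioi t)| ≤ dK := by
    intro a y t
    by_cases h0 : t < 0
    · have : {ω | t < Rhat ω} = Set.univ :=
        Set.eq_univ_of_forall fun ω => lt_of_lt_of_le h0 (hRh01 ω).1
      have hp := hprob a y
      rw [hGlow a y t h0, hHI, this]
      simpa using hd0
    · by_cases h1 : t > 1
      · have : {ω | t < Rhat ω} = ∅ :=
          Set.eq_empty_of_forall_notMem fun ω (h : t < Rhat ω) => absurd (hRh01 ω).2 (by linarith)
        rw [hGhigh a y t h1, hHI, this]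
        simpa using hd0
      · exact hdK a y t ⟨not_lt.1 h0, not_lt.1 h1⟩
  -- conditional means
  have hcm01 : ∀ p : Ω → ℝ, Measurable p → (∀ ω, p ω ∈ Set.Icc (0:ℝ) 1) → ∀ a y,
      cm p a y ∈ Set.Icc (0:ℝ) 1 := by
    intro p hp hp01 a y
    have := hprob a y
    exact integral_mem_Icc _ p hp hp01
  have hloss : ∀ p : Ω → ℝ, Measurable p → (∀ ω, p ω ∈ Set.Icc (0:ℝ) 1) →
      loss p = lossFn P L (cm p) := fun p hp hp01 =>
    loss_eq μ hY hA hpos L hL00 hL11 p hp hp01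
  -- the relaxed feasible set
  set K : Set (Bool → Bool → ℝ) := {v | (∀ a y, v a y ∈ Set.Icc (0:ℝ) 1) ∧
    ∀ a, ∀ s ∈ Set.Icc (0:ℝ) 1, s * P a false * ((G a false).real (Set.Ioi s) - v a false) ≤
      (1 - s) * P a true * ((G a true).real (Set.Ioi s) - v a true)} with hK
  have hev : ∀ a y, Continuous fun v : Bool → Bool → ℝ => v a y := fun a y => by fun_prop
  have hKc : IsCompact K := by
    have hcomp : IsCompact (Set.univ.pi fun _ : Bool => Set.univ.pi fun _ : Bool =>
        Set.Icc (0:ℝ) 1) := isCompact_univ_pi fun _ => isCompact_univ_pi fun _ => isCompact_Icc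
    refine hcomp.of_isClosed_subset ?_ ?_
    · refine IsClosed.inter (s₁ := {v : Bool → Bool → ℝ | ∀ a y, v a y ∈ Set.Icc (0:ℝ) 1})
        (s₂ := {v : Bool → Bool → ℝ | ∀ a, ∀ s ∈ Set.Icc (0:ℝ) 1,
          s * P a false * ((G a false).real (Set.Ioi s) - v a false) ≤
            (1 - s) * P a true * ((G a true).real (Set.Ioi s) - v a true)}) ?_ ?_
      · have : {v : Bool → Bool → ℝ | ∀ a y, v a y ∈ Set.Icc (0:ℝ) 1} =
            ⋂ a, ⋂ y, {v : Bool → Bool → ℝ | v a y ∈ Set.Icc (0:ℝ) 1} := by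
          ext v; simp
        rw [this]
        exact isClosed_iInter fun a => isClosed_iInter fun y => isClosed_Icc.preimage (hev a y)
      · simp only [Set.ofPred_forall]
        exact isClosed_iInter fun a => isClosed_iInter fun s => isClosed_iInter fun _ =>
          isClosed_le (by fun_prop) (by fun_prop)
    · intro v hv
      simp only [Set.mem_pi]
      exact fun a _ y _ => hv.1 a y
  have hmemK : ∀ f : β × Bool → ℝ, Measurable f → (∀ z, f z ∈ Set.Icc (0:ℝ) 1) →
      cm (fun ω => f (X ω, A ω)) ∈ K := by
    intro f hf hf01
    refine ⟨hcm01 _ (hf.comp (hX.prodMk hA)) fun ω => hf01 _, fun a s _ => ?_⟩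
    rw [hGI, hGI]
    exact dual_ineq μ hY hm hAm hpos Rstar _ hRsm hRs (hf.comp hpairm) (fun ω => hf01 _) a s
  have hlc : Continuous (lossFn P L) := by
    unfold lossFn
    fun_prop
  -- every point of the relaxed set is nearly dominated by thresholds of `Rhat`
  have hdom : ∀ v ∈ K, ∃ h : Bool → ℝ → ℝ, (∀ a, Measurable (h a)) ∧
      (∀ a r, h a r ∈ Set.Icc (0:ℝ) 1) ∧
      (∀ a, cm (fun ω => h a (Rhat ω)) a false ≤ v a false + dK) ∧
      (∀ a, v a true - dK ≤ cm (fun ω => h a (Rhat ω)) a true) := by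
    intro v hv
    have : ∀ a, ∃ h : ℝ → ℝ, Measurable h ∧ (∀ r, h r ∈ Set.Icc (0:ℝ) 1) ∧
        cm (fun ω => h (Rhat ω)) a false ≤ v a false + dK ∧
        v a true - dK ≤ cm (fun ω => h (Rhat ω)) a true := by
      intro a
      have hone : (G a false).real (Set.Ici 1) = 0 :=
        (map_measureReal_apply hRsm' measurableSet_Ici).trans
          (bayes_lt_one μ hY hm hAm hpos Rstar hRsm hRs a)
      obtain ⟨τ, l, hl, e0, e1⟩ := neyman_pearson (G a false) (G a true) (hGlow a false)
        (hGlow a true) hone (P a false) (P a true) (v a false) (v a true) (hP _ _) (hP _ _)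
        (hv.1 a false) (hv.1 a true) (hv.2 a)
      have hp := hprob a
      have c : ∀ y, cm (fun ω => thr τ l (Rhat ω)) a y =
          l * (H a y).real (Set.Ici τ) + (1 - l) * (H a y).real (Set.Ioi τ) := fun y =>
        integral_thr _ Rhat hRh τ l
      have t0 := abs_le.1 (thr_transfer (H a false) (G a false) dK (hdK' a false) τ l hl)
      have t1 := abs_le.1 (thr_transfer (H a true) (G a true) dK (hdK' a true) τ l hl)
      refine ⟨thr τ l, thr_measurable τ l, thr_mem τ l hl, ?_, ?_⟩
      · rw [c]; linarith [t0.2]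
      · rw [c]; linarith [t1.1]
    choose h h1 h2 h3 h4 using this
    exact ⟨h, h1, h2, h3, h4⟩
  -- affine modifications of the derived predictors
  have hbuild : ∀ (h : Bool → ℝ → ℝ), (∀ a, Measurable (h a)) →
      (∀ a r, h a r ∈ Set.Icc (0:ℝ) 1) → ∀ α β' : Bool → ℝ, (∀ a, 0 ≤ α a) → (∀ a, 0 ≤ β' a) →
      (∀ a, α a + β' a ≤ 1) → ∃ g : ℝ × Bool → ℝ, Measurable g ∧ (∀ z, g z ∈ Set.Icc (0:ℝ) 1) ∧
        ∀ a y, cm (fun ω => g (Rhat ω, A ω)) a y =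
          α a * cm (fun ω => h a (Rhat ω)) a y + β' a := by
    intro h hhm hh01 α β' hα hβ hαβ
    refine ⟨fun z => α z.2 * h z.2 z.1 + β' z.2, ?_, ?_, ?_⟩
    · refine measurable_from_prod_countable_left fun b => ?_
      exact ((hhm b).const_mul (α b)).add_const (β' b)
    · intro z
      have e1 := mul_nonneg (hα z.2) (hh01 z.2 z.1).1
      have e2 := mul_le_of_le_one_right (hα z.2) (hh01 z.2 z.1).2
      exact ⟨by linarith [hβ z.2], by linarith [hαβ z.2]⟩
    · intro a y
      have := hprob a y
      have hae : ∀ᵐ ω ∂(μ[|{ω | A ω = a ∧ Y ω = y}]),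
          α (A ω) * h (A ω) (Rhat ω) + β' (A ω) = α a * h a (Rhat ω) + β' a := by
        filter_upwards [ae_cond_mem (meas_cell hY hA a y)] with ω hω
        rw [hω.1]
      show ∫ ω, (α (A ω) * h (A ω) (Rhat ω) + β' (A ω)) ∂(μ[|{ω | A ω = a ∧ Y ω = y}]) = _
      rw [integral_congr_ae hae, integral_add, integral_const_mul]
      · simp [cm]
      · exact (integrable_of_Icc _ _ ((hhm a).comp hRh) fun ω => hh01 a _).const_mul _
      · exact integrable_const _
  have hsq : dK ≤ 2 * Real.sqrt 2 * dK := by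
    have : (1:ℝ) ≤ Real.sqrt 2 := Real.one_le_sqrt.2 (by norm_num)
    exact le_mul_of_one_le_left hd0 (by linarith)
  -- the common optimisation argument
  have hmain : ∀ C : (Bool → Bool → ℝ) → Prop, IsClosed {v | C v} → C (fun _ _ => 0) →
      (∀ v ∈ K, C v → ∀ h : Bool → ℝ → ℝ, (∀ a, Measurable (h a)) →
        (∀ a r, h a r ∈ Set.Icc (0:ℝ) 1) →
        (∀ a, cm (fun ω => h a (Rhat ω)) a false ≤ v a false + dK) →
        (∀ a, v a true - dK ≤ cm (fun ω => h a (Rhat ω)) a true) →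
        ∃ α β' : Bool → ℝ, (∀ a, 0 ≤ α a) ∧ (∀ a, 0 ≤ β' a) ∧ (∀ a, α a + β' a ≤ 1) ∧
          C (fun a y => α a * cm (fun ω => h a (Rhat ω)) a y + β' a) ∧
          (∀ a, α a * cm (fun ω => h a (Rhat ω)) a false + β' a ≤ v a false + dK) ∧
          (∀ a, v a true - dK ≤ α a * cm (fun ω => h a (Rhat ω)) a true + β' a)) →
      ∃ g : ℝ × Bool → ℝ, Measurable g ∧ (∀ z, g z ∈ Set.Icc (0:ℝ) 1) ∧
        C (cm (fun ω => g (Rhat ω, A ω))) ∧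
        loss (fun ω => g (Rhat ω, A ω)) ≤
          sInf {l : ℝ | ∃ f : β × Bool → ℝ, Measurable f ∧
              (∀ z, f z ∈ Set.Icc (0:ℝ) 1) ∧
              C (cm (fun ω => f (X ω, A ω))) ∧ l = loss (fun ω => f (X ω, A ω))} +
            2 * Real.sqrt 2 * dK := by
    intro C hC hC0 hgeom
    have hcm0 : cm (fun ω => (fun _ : β × Bool => (0:ℝ)) (X ω, A ω)) = fun _ _ => 0 := by
      funext a y; simp [cm]
    have hz : ∀ z : β × Bool, (fun _ : β × Bool => (0:ℝ)) z ∈ Set.Icc (0:ℝ) 1 := by simp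
    have hne : (K ∩ {v | C v}).Nonempty := by
      refine ⟨_, hmemK (fun _ => 0) measurable_const hz, ?_⟩
      rw [hcm0]; exact hC0
    obtain ⟨v, hv, hvmin⟩ := (hKc.inter_right hC).exists_isMinOn hne hlc.continuousOn
    have hle : lossFn P L v ≤ sInf {l : ℝ | ∃ f : β × Bool → ℝ, Measurable f ∧
              (∀ z, f z ∈ Set.Icc (0:ℝ) 1) ∧
              C (cm (fun ω => f (X ω, A ω))) ∧ l = loss (fun ω => f (X ω, A ω))} := by
      refine le_csInf ⟨_, fun _ => 0, measurable_const, hz, by rw [hcm0]; exact hC0, rfl⟩ ?_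
      rintro _ ⟨f, hf, hf01, hfC, rfl⟩
      rw [hloss (fun ω => f (X ω, A ω)) (hf.comp (hX.prodMk hA)) fun ω => hf01 _]
      exact hvmin ⟨hmemK f hf hf01, hfC⟩
    obtain ⟨h, h1, h2, h3, h4⟩ := hdom v hv.1
    obtain ⟨α, β', a1, a2, a3, a4, a5, a6⟩ := hgeom v hv.1 hv.2 h h1 h2 h3 h4
    obtain ⟨g, hg, hg01, hgc⟩ := hbuild h h1 h2 α β' a1 a2 a3
    have hge : cm (fun ω => g (Rhat ω, A ω)) =
        fun a y => α a * cm (fun ω => h a (Rhat ω)) a y + β' a := by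
      funext a y; exact hgc a y
    refine ⟨g, hg, hg01, by rw [hge]; exact a4, ?_⟩
    rw [hloss (fun ω => g (Rhat ω, A ω)) (hg.comp (hRh.prodMk hA)) fun ω => hg01 _, hge]
    have := lossFn_le P L v (fun a y => α a * cm (fun ω => h a (Rhat ω)) a y + β' a) dK hd0
      (fun a y => (hP a y).le) hsum hL a5 a6
    linarith
  constructor
  · refine hmain (fun v => ∀ y, v false y = v true y) ?_ (fun _ => rfl) ?_
    · simp only [Set.ofPred_forall]
      exact isClosed_iInter fun y => isClosed_eq (hev _ _) (hev _ _)
    · intro v hv hCv h h1 h2 h3 h4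
      have e0 : ∀ a, v a false = v false false := by
        intro a; cases a
        · rfl
        · exact (hCv false).symm
      have e1 : ∀ a, v a true = v false true := by
        intro a; cases a
        · rfl
        · exact (hCv true).symm
      obtain ⟨α, β', b1, b2, b3, b4, b5, b6, b7⟩ := geom_odds
        (fun a => cm (fun ω => h a (Rhat ω)) a false) (fun a => cm (fun ω => h a (Rhat ω)) a true)
        (fun a => hcm01 _ ((h1 a).comp hRh) (fun ω => h2 a _) a false)
        (fun a => hcm01 _ ((h1 a).comp hRh) (fun ω => h2 a _) a true)
        (v false false) (v false true) dK (hv.1 _ _) (hv.1 _ _)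
        (fun a => (h3 a).trans_eq (by rw [e0 a])) (fun a => le_trans (by rw [e1 a]) (h4 a))
      refine ⟨α, β', b1, b2, b3, ?_, fun a => (b6 a).trans_eq (by rw [e0 a]),
        fun a => le_trans (by rw [e1 a]) (b7 a)⟩
      intro y; cases y
      · exact b4
      · exact b5
  · refine hmain (fun v => v false true = v true true) ?_ rfl ?_
    · exact isClosed_eq (hev _ _) (hev _ _)
    · intro v hv hCv h h1 h2 h3 h4
      have e1 : ∀ a, v a true = v false true := by
        intro a; cases a
        · rfl
        · exact hCv.symm
      obtain ⟨α, β', b1, b2, b3, b4, b5, b6⟩ := geom_opp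
        (fun a => cm (fun ω => h a (Rhat ω)) a false) (fun a => cm (fun ω => h a (Rhat ω)) a true)
        (fun a => hcm01 _ ((h1 a).comp hRh) (fun ω => h2 a _) a false)
        (fun a => hcm01 _ ((h1 a).comp hRh) (fun ω => h2 a _) a true)
        (fun a => v a false) (v false true) dK
        h3 (fun a => le_trans (by rw [e1 a]) (h4 a))
      exact ⟨α, β', b1, b2, b3, b4, b5, fun a => le_trans (by rw [e1 a]) (b6 a)⟩
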